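/- Let d be a positive integer, let H : ℝ^d → ℝ be continuously differentiable, and let S : ℝ^d → Matrix (Fin d) (Fin d) ℝ satisfy S(w)ᵀ = −S(w) for all w. Let Δt ∈ ℝ and suppose z⁰, z¹ ∈ ℝ^d satisfy the average vector field (AVF) step z¹ − z⁰ = Δt · S((z⁰ + z¹)/2) · ∫₀¹ ∇H(ξ z¹ + (1−ξ) z⁰) dξ. Then the Hamiltonian is exactly preserved: H(z¹) = H(z⁰). -/

import Mathlib

open Matrix

/-- A skew-symmetric real matrix has vanishing quadratic form. -/
theorem Matrix.dotProduct_mulVec_self_eq_zero_of_transpose_eq_neg {n : Type*} [Fintype n]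
    {A : Matrix n n ℝ} (hA : Aᵀ = -A) (v : n → ℝ) : v ⬝ᵥ A *ᵥ v = 0 := by
  have h : v ⬝ᵥ A *ᵥ v = -(v ⬝ᵥ A *ᵥ v) := by
    conv_lhs => rw [dotProduct_mulVec, ← mulVec_transpose, hA, neg_mulVec, neg_dotProduct,
      dotProduct_comm]
  linarith

/-- The mean value identity for the averaged gradient along a segment. -/
theorem inner_sub_integral_gradient_segment {E : Type*} [NormedAddCommGroup E]
    [InnerProductSpace ℝ E] [CompleteSpace E] {H : E → ℝ} (hH : ContDiff ℝ 1 H) (x y : E) :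
    inner ℝ (y - x) (∫ ξ in (0 : ℝ)..1, gradient H (ξ • y + (1 - ξ) • x)) = H y - H x := by
  have hcont : Continuous fun ξ : ℝ => gradient H (ξ • y + (1 - ξ) • x) := by
    have := hH.continuous_fderiv one_ne_zero
    unfold gradient
    fun_prop
  have hderiv (ξ : ℝ) : HasDerivAt (fun ξ : ℝ => H (ξ • y + (1 - ξ) • x))
      (inner ℝ (y - x) (gradient H (ξ • y + (1 - ξ) • x))) ξ := by
    have hline : HasDerivAt (fun ξ : ℝ => ξ • y + (1 - ξ) • x) (y - x) ξ := by
      have h := ((hasDerivAt_id' ξ).smul_const y).add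
        (((hasDerivAt_id' ξ).const_sub 1).smul_const x)
      rwa [one_smul, neg_one_smul, ← sub_eq_add_neg] at h
    have hgrad := ((hH.differentiable one_ne_zero) (ξ • y + (1 - ξ) • x)).hasGradientAt
    have hcomp := hgrad.hasFDerivAt.comp_hasDerivAt ξ hline
    rwa [InnerProductSpace.toDual_apply_apply, real_inner_comm] at hcomp
  have hint := intervalIntegral.integral_eq_sub_of_hasDerivAt (a := 0) (b := 1)
    (fun ξ _ => hderiv ξ) ((continuous_const.inner hcont).intervalIntegrable 0 1)
  have hcomm := (innerSL ℝ (y - x)).intervalIntegral_comp_comm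
    (hcont.intervalIntegrable (μ := MeasureTheory.volume) 0 1)
  simp only [innerSL_apply_apply] at hcomm
  rw [← hcomm, hint]
  simp

/-- The average vector field (AVF) method exactly preserves the Hamiltonian of a
skew-gradient system `ż = S(z) ∇H(z)`. -/
theorem avf_step_preserves_hamiltonian
    (d : ℕ) (hd : 0 < d)
    (H : EuclideanSpace ℝ (Fin d) → ℝ) (hH : ContDiff ℝ 1 H)
    (S : EuclideanSpace ℝ (Fin d) → Matrix (Fin d) (Fin d) ℝ)
    (hS : ∀ w, (S w)ᵀ = -(S w))
    (Δt : ℝ) (z0 z1 : EuclideanSpace ℝ (Fin d))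
    (hstep : z1 - z0 = Δt • (S ((1/2 : ℝ) • (z0 + z1))).mulVec
      ((∫ ξ in (0:ℝ)..1, gradient H (ξ • z1 + (1 - ξ) • z0)) :
        EuclideanSpace ℝ (Fin d))) :
    H z1 = H z0 := by
  rw [← sub_eq_zero, ← inner_sub_integral_gradient_segment hH z0 z1,
    EuclideanSpace.inner_eq_star_dotProduct]
  have hstep' : (z1 - z0).ofLp = _ := hstep
  rw [hstep', star_trivial, dotProduct_smul,
    Matrix.dotProduct_mulVec_self_eq_zero_of_transpose_eq_neg (hS _), smul_zero]
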